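/- arXiv:1504.02236 — 4 statements merged into one kernel-verified Lean document; each statement's English description precedes it below -/
import Mathlib

section
/- Let d, m, N ≥ 1 and T > 0. Let K : ℝ^d → ℝ^d be continuous with ‖K(ξ)‖ ≤ C_K(1 + ‖ξ‖) for all ξ. Let f_1, …, f_m : ℝ^{dm} → ℝ^d be continuous with f_k(y) · y_k ≤ F₁ max_{l} ‖y_l‖² + F₂ for all y = (y_1,…,y_m) and all k. Let g : ℝ^{dm} → C(ℝ^d; ℝ^d) be such that g(y)(x) · x ≤ G₁‖x‖² + G₂ max_l ‖y_l‖² + G₃ for all x, y. Let b_1, …, b_m : [0,T] → ℝ^d be measurable with ‖b_k(t)‖ ≤ M₁ for all t and k. Suppose y_1,…,y_m, x_1,…,x_N : [0,T] → ℝ^d are locally Lipschitz and satisfy, for almost every t ∈ [0,T], the system ẏ_k(t) = (1/N) Σ_{j=1}^N K(y_k(t) − x_j(t)) + f_k(y(t)) + b_k(t) for k = 1,…,m and ẋ_i(t) = (1/N) Σ_{j=1}^N K(x_i(t) − x_j(t)) + g(y(t))(x_i(t)) for i = 1,…,N. Then there exist constants C₁, C₂ > 0, depending only on C_K, F₁,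 F₂, G₁, G₂, G₃ and M₁ (in particular, independent of N, T and the solution), such that for all t ∈ [0,T], max over all pairs (k,i) of (‖y_k(t)‖² + ‖x_i(t)‖²) ≤ ( max over (k,i) of (‖y_k(0)‖² + ‖x_i(0)‖²) + 2C₂ t ) e^{2C₁ t}. -/
open MeasureTheory RealInnerProductSpace

/-- Integral Gronwall argument for a finite family of absolutely continuous functions. -/
lemma gronwall_family {ι : Type*} [Fintype ι] [Nonempty ι] (u : ι → ℝ → ℝ) (T c e : ℝ)
    (hT : 0 ≤ T) (hc : 0 ≤ c) (he : 0 ≤ e)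
    (hu : ∀ p, AbsolutelyContinuousOnInterval (u p) 0 T)
    (hd : ∀ᵐ t ∂(volume.restrict (Set.Icc (0 : ℝ) T)), ∀ p,
      deriv (u p) t ≤ c * (⨆ q, u q t) + e) :
    (⨆ p, u p T) ≤ ((⨆ p, u p 0) + e * T) * Real.exp (c * T) := by
  have hbdd : ∀ t, BddAbove (Set.range fun p => u p t) := fun t => Set.finite_range _ |>.bddAbove
  have hSc : ContinuousOn (fun t => ⨆ q, u q t) (Set.Icc 0 T) := by
    have : (fun t => ⨆ q, u q t) = fun t => Finset.univ.sup' Finset.univ_nonempty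
        (fun q => u q t) := by
      funext t; rw [Finset.sup'_univ_eq_ciSup]
    rw [this]
    apply ContinuousOn.finset_sup'_apply
    intro i _
    have := (hu i).continuousOn
    rwa [Set.uIcc_of_le hT] at this
  set S : ℝ → ℝ := Set.IccExtend hT ((Set.Icc 0 T).domRestrict (fun t => ⨆ q, u q t)) with hS
  have hScont : Continuous S := hSc.domRestrict.Icc_extend'
  have hSeq : ∀ t ∈ Set.Icc 0 T, S t = ⨆ q, u q t := by
    intro t ht
    rw [hS, Set.IccExtend_of_mem _ _ ht]; rfl
  set A : ℝ := (⨆ p, u p 0) + e * T with hA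
  set W : ℝ → ℝ := fun s => A + c * ∫ r in (0:ℝ)..s, S r with hW
  have hWd : ∀ s, HasDerivAt W (c * S s) s := by
    intro s
    have h := (hScont.integral_hasStrictDerivAt 0 s).hasDerivAt
    exact (h.const_mul c).const_add A
  have key : ∀ s ∈ Set.Icc 0 T, S s ≤ W s := by
    intro s hs
    rw [hSeq s hs]
    apply ciSup_le
    intro p
    have hsub : Set.uIcc 0 s ⊆ Set.uIcc 0 T := by
      rw [Set.uIcc_of_le hT, Set.uIcc_of_le hs.1]; exact Set.Icc_subset_Icc_right hs.2
    have hac := (hu p).mono hsub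
    have h1 := hac.integral_deriv_eq_sub
    have h2 : ∫ r in (0:ℝ)..s, deriv (u p) r ≤ ∫ r in (0:ℝ)..s, (c * S r + e) := by
      apply intervalIntegral.integral_mono_ae_restrict hs.1 hac.intervalIntegrable_deriv
      · exact (by fun_prop : Continuous fun r => c * S r + e).intervalIntegrable _ _
      · have hd' := ae_restrict_of_ae_restrict_of_subset (Set.Icc_subset_Icc_right hs.2) hd
        filter_upwards [hd', ae_restrict_mem measurableSet_Icc] with r hr hmem
        rw [hSeq r ⟨hmem.1, hmem.2.trans hs.2⟩]
        exact hr p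
    rw [intervalIntegral.integral_add ((by fun_prop : Continuous fun r => c * S r).intervalIntegrable _ _)
      (by simp), intervalIntegral.integral_const_mul, intervalIntegral.integral_const] at h2
    have h3 : u p 0 ≤ ⨆ p, u p 0 := le_ciSup (hbdd 0) p
    have h4 : e * s ≤ e * T := mul_le_mul_of_nonneg_left hs.2 he
    simp only [smul_eq_mul, sub_zero] at h2
    simp only [hW, hA]
    linarith
  have hg := le_gronwallBound_of_liminf_deriv_right_le (f := W) (f' := fun s => c * S s)
    (δ := A) (K := c) (ε := 0) (a := 0) (b := T)
    (fun s _ => (hWd s).continuousAt.continuousWithinAt)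
    (fun s _ r hr => by
      have := (hWd s).hasDerivWithinAt.liminf_right_slope_le hr
      simpa [slope_def_field, div_eq_inv_mul] using this)
    (by simp [hW])
    (fun s hs => by
      have := mul_le_mul_of_nonneg_left (key s ⟨hs.1, hs.2.le⟩) hc
      simpa using this) T ⟨hT, le_rfl⟩
  rw [gronwallBound_ε0, sub_zero] at hg
  rw [← hSeq T ⟨hT, le_rfl⟩]
  exact (key T ⟨hT, le_rfl⟩).trans hg

/-- The square of the norm of a Lipschitz curve is absolutely continuous. -/
lemma ac_norm_sq {E : Type*} [NormedAddCommGroup E] (y : ℝ → E) (T : ℝ) (hT : 0 ≤ T)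
    (h : ∃ L : NNReal, LipschitzOnWith L y (Set.Icc 0 T)) :
    AbsolutelyContinuousOnInterval (fun t => ‖y t‖ ^ 2) 0 T := by
  obtain ⟨L, hL⟩ := h
  have h1 : LipschitzOnWith L (fun t => ‖y t‖) (Set.uIcc 0 T) := by
    rw [Set.uIcc_of_le hT]
    simpa [Function.comp_def] using lipschitzWith_one_norm.comp_lipschitzOnWith hL
  have h2 := h1.absolutelyContinuousOnInterval
  simpa [sq] using h2.fun_mul h2

/-- Interaction term estimate. -/
lemma avg_est {E : Type*} [NormedAddCommGroup E] [InnerProductSpace ℝ E] (N : ℕ) (hN : 1 ≤ N)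
    (K : E → E) (CK : ℝ) (hCK : 0 < CK) (hK : ∀ ξ, ‖K ξ‖ ≤ CK * (1 + ‖ξ‖))
    (z : E) (x : Fin N → E) (S : ℝ) (hz : ‖z‖ ^ 2 ≤ S) (hx : ∀ j, ‖x j‖ ^ 2 ≤ S) :
    ⟪(N : ℝ)⁻¹ • ∑ j, K (z - x j), z⟫ ≤ CK * (1 + 3 * S) := by
  have hterm : ∀ j, ⟪K (z - x j), z⟫ ≤ CK * (1 + 3 * S) := by
    intro j
    have h1 := real_inner_le_norm (K (z - x j)) z
    have h2 : ‖K (z - x j)‖ ≤ CK * (1 + (‖z‖ + ‖x j‖)) :=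
      (hK _).trans (by gcongr; exact norm_sub_le _ _)
    have h3 : ‖K (z - x j)‖ * ‖z‖ ≤ CK * (1 + (‖z‖ + ‖x j‖)) * ‖z‖ := by gcongr
    have h4 : (1 + (‖z‖ + ‖x j‖)) * ‖z‖ ≤ 1 + 3 * S := by
      nlinarith [sq_nonneg (‖z‖ - 1), sq_nonneg (‖z‖ - ‖x j‖), hx j, sq_nonneg ‖z‖]
    have h5 := mul_le_mul_of_nonneg_left h4 hCK.le
    linarith
  rw [real_inner_smul_left, sum_inner]
  have hsum : ∑ j, ⟪K (z - x j), z⟫ ≤ N * (CK * (1 + 3 * S)) := by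
    have := Finset.sum_le_sum (fun j (_ : j ∈ Finset.univ) => hterm j)
    simpa using this
  have hN' : (0:ℝ) < N := by exact_mod_cast hN
  rw [inv_mul_le_iff₀ hN']
  exact hsum

/-- A priori growth bound for the coupled leader–follower ODE system.
There exist constants `C₁, C₂ > 0` depending only on `C_K, F₁, F₂, G₁, G₂, G₃, M₁`
(in particular independent of `d, m, N, T` and the solution) such that any locally
Lipschitz (here: Lipschitz on `[0,T]`) solution of the system satisfies, for all
`t ∈ [0,T]`,
`max_{(k,i)} (‖y_k(t)‖² + ‖x_i(t)‖²) ≤ (max_{(k,i)} (‖y_k(0)‖² + ‖x_i(0)‖²) + 2C₂ t) e^{2C₁ t}`. -/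
theorem stmt_3 (CK F₁ F₂ G₁ G₂ G₃ M₁ : ℝ) (hCK : 0 < CK) :
    ∃ C₁ C₂ : ℝ, 0 < C₁ ∧ 0 < C₂ ∧
      ∀ (d m N : ℕ), 1 ≤ d → 1 ≤ m → 1 ≤ N → ∀ (T : ℝ), 0 < T →
      ∀ (K : EuclideanSpace ℝ (Fin d) → EuclideanSpace ℝ (Fin d)),
        Continuous K → (∀ ξ, ‖K ξ‖ ≤ CK * (1 + ‖ξ‖)) →
      ∀ (f : Fin m → (Fin m → EuclideanSpace ℝ (Fin d)) → EuclideanSpace ℝ (Fin d)),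
        (∀ k, Continuous (f k)) →
        (∀ k (y : Fin m → EuclideanSpace ℝ (Fin d)),
          ⟪f k y, y k⟫ ≤ F₁ * (⨆ l, ‖y l‖ ^ 2) + F₂) →
      ∀ (g : (Fin m → EuclideanSpace ℝ (Fin d)) →
          EuclideanSpace ℝ (Fin d) → EuclideanSpace ℝ (Fin d)),
        (∀ y, Continuous (g y)) →
        (∀ y x, ⟪g y x, x⟫ ≤ G₁ * ‖x‖ ^ 2 + G₂ * (⨆ l, ‖y l‖ ^ 2) + G₃) →
      ∀ (b : Fin m → ℝ → EuclideanSpace ℝ (Fin d)),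
        (∀ k, Measurable (b k)) → (∀ k, ∀ t ∈ Set.Icc (0 : ℝ) T, ‖b k t‖ ≤ M₁) →
      ∀ (y : Fin m → ℝ → EuclideanSpace ℝ (Fin d))
        (x : Fin N → ℝ → EuclideanSpace ℝ (Fin d)),
        (∀ k, ∃ Lk : NNReal, LipschitzOnWith Lk (y k) (Set.Icc 0 T)) →
        (∀ i, ∃ Li : NNReal, LipschitzOnWith Li (x i) (Set.Icc 0 T)) →
        (∀ᵐ t ∂(MeasureTheory.volume.restrict (Set.Icc (0 : ℝ) T)),
          (∀ k, HasDerivAt (y k)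
            ((N : ℝ)⁻¹ • ∑ j, K (y k t - x j t) + f k (fun l => y l t) + b k t) t) ∧
          (∀ i, HasDerivAt (x i)
            ((N : ℝ)⁻¹ • ∑ j, K (x i t - x j t) + g (fun l => y l t) (x i t)) t)) →
      ∀ t ∈ Set.Icc (0 : ℝ) T,
        (⨆ k, ⨆ i, (‖y k t‖ ^ 2 + ‖x i t‖ ^ 2)) ≤
          ((⨆ k, ⨆ i, (‖y k 0‖ ^ 2 + ‖x i 0‖ ^ 2)) + 2 * C₂ * t) *
            Real.exp (2 * C₁ * t) := by
  refine ⟨6 * CK + |F₁| + |M₁| + |G₁| + |G₂|, 2 * CK + |F₂| + |M₁| + |G₃|, by positivity,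
    by positivity, ?_⟩
  intro d m N _ hm hN T hT K _ hK f _ hf g _ hg b _ hb y x hy hx hode t ht
  haveI : Nonempty (Fin m) := ⟨⟨0, hm⟩⟩
  haveI : Nonempty (Fin N) := ⟨⟨0, hN⟩⟩
  have hsup : ∀ s, (⨆ k, ⨆ i, (‖y k s‖ ^ 2 + ‖x i s‖ ^ 2)) =
      ⨆ p : Fin m × Fin N, (‖y p.1 s‖ ^ 2 + ‖x p.2 s‖ ^ 2) := by
    intro s
    rw [ciSup_prod (Set.finite_range _).bddAbove]
  rw [hsup, hsup]
  have hsub : Set.Icc 0 t ⊆ Set.Icc 0 T := Set.Icc_subset_Icc_right ht.2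
  have hy' : ∀ k, ∃ L : NNReal, LipschitzOnWith L (y k) (Set.Icc 0 t) :=
    fun k => (hy k).imp fun _ h => h.mono hsub
  have hx' : ∀ i, ∃ L : NNReal, LipschitzOnWith L (x i) (Set.Icc 0 t) :=
    fun i => (hx i).imp fun _ h => h.mono hsub
  apply gronwall_family (fun (p : Fin m × Fin N) s => ‖y p.1 s‖ ^ 2 + ‖x p.2 s‖ ^ 2) t _ _ ht.1
    (by positivity) (by positivity)
  · intro p
    exact (ac_norm_sq _ t ht.1 (hy' p.1)).fun_add (ac_norm_sq _ t ht.1 (hx' p.2))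
  · have hode' := ae_restrict_of_ae_restrict_of_subset hsub hode
    filter_upwards [hode', ae_restrict_mem measurableSet_Icc] with s hs hmem p
    obtain ⟨k, i⟩ := p
    have hder := ((hs.1 k).norm_sq.add (hs.2 i).norm_sq).deriv
    have hder' : deriv (fun s => ‖y k s‖ ^ 2 + ‖x i s‖ ^ 2) s = _ := hder
    rw [hder']
    set S := ⨆ q : Fin m × Fin N, (‖y q.1 s‖ ^ 2 + ‖x q.2 s‖ ^ 2) with hS
    have hle : ∀ k i, ‖y k s‖ ^ 2 + ‖x i s‖ ^ 2 ≤ S := fun k i =>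
      le_ciSup (f := fun q : Fin m × Fin N => ‖y q.1 s‖ ^ 2 + ‖x q.2 s‖ ^ 2)
        (Set.finite_range _).bddAbove (k, i)
    have hyS : ∀ k, ‖y k s‖ ^ 2 ≤ S := fun k => by
      have := hle k i
      nlinarith [sq_nonneg ‖x i s‖]
    have hxS : ∀ i, ‖x i s‖ ^ 2 ≤ S := fun i => by
      have := hle k i
      nlinarith [sq_nonneg ‖y k s‖]
    have hS0 : 0 ≤ S := (sq_nonneg _).trans (hyS k)
    set Y := ⨆ l, ‖y l s‖ ^ 2 with hY
    have hYS : Y ≤ S := ciSup_le hyS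
    have hY0 : 0 ≤ Y := Real.iSup_nonneg fun l => sq_nonneg _
    have e1 := avg_est N hN K CK hCK hK (y k s) (fun j => x j s) S (hyS k) hxS
    have e2 := avg_est N hN K CK hCK hK (x i s) (fun j => x j s) S (hxS i) hxS
    have e3 : ⟪f k (fun l => y l s), y k s⟫ ≤ |F₁| * S + |F₂| := by
      refine (hf k (fun l => y l s)).trans ?_
      exact add_le_add (mul_le_mul (le_abs_self _) hYS hY0 (abs_nonneg _)) (le_abs_self _)
    have e4 : ⟪g (fun l => y l s) (x i s), x i s⟫ ≤ |G₁| * S + |G₂| * S + |G₃| := by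
      refine (hg (fun l => y l s) (x i s)).trans ?_
      exact add_le_add (add_le_add
        (mul_le_mul (le_abs_self _) (hxS i) (sq_nonneg _) (abs_nonneg _))
        (mul_le_mul (le_abs_self _) hYS hY0 (abs_nonneg _))) (le_abs_self _)
    have e5 : ⟪b k s, y k s⟫ ≤ |M₁| * (1 + S) := by
      have h1 := real_inner_le_norm (b k s) (y k s)
      have h2 : ‖b k s‖ ≤ |M₁| := (hb k s (hsub hmem)).trans (le_abs_self _)
      have h3 : ‖y k s‖ ≤ 1 + S := by
        nlinarith [hyS k, sq_nonneg (‖y k s‖ - 1), sq_nonneg ‖y k s‖]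
      exact h1.trans (mul_le_mul h2 h3 (norm_nonneg _) (abs_nonneg _))
    rw [real_inner_comm, real_inner_comm _ (x i s), inner_add_left, inner_add_left, inner_add_left]
    have h0 := abs_nonneg M₁
    linarith
end

section
/- Let n ≥ 1, let K ⊆ ℝ^n be convex and compact, and let F, G : ℝ^n → ℝ be twice continuously differentiable. For a compactly supported Borel probability measure ν on ℝ^n define H¹(ν) = (1/2) ∫∫ F(z − z') dν(z) dν(z') + ∫ G(z) dν(z). Then there exists C ≥ 0, depending only on F, G and K, such that for all Borel probability measures ν₀, ν₁ supported in K, every coupling ρ of ν₀ and ν₁, and every s ∈ [0,1]: H¹(ν_s) ≤ (1−s) H¹(ν₀) + s H¹(ν₁) + C s(1−s) ∫ ‖z₀ − z₁‖² dρ(z₀, z₁), where ν_s is the pushforward of ρ under (z₀, z₁) ↦ (1−s)z₀ + s z₁. In particular, taking ρ an optimal coupling for the 2-Wasserstein distance, H¹ is semiconvex along geodesics. -/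
open MeasureTheory

/-- The interaction-plus-potential functional
`H¹(ν) = (1/2) ∫∫ F(z − z') dν(z) dν(z') + ∫ G(z) dν(z)`. -/
noncomputable def Hone (n : ℕ) (F G : EuclideanSpace ℝ (Fin n) → ℝ)
    (ν : Measure (EuclideanSpace ℝ (Fin n))) : ℝ :=
  (1 / 2) * (∫ z, ∫ z', F (z - z') ∂ν ∂ν) + ∫ z, G z ∂ν

lemma aux_semiconvex {E : Type*} [NormedAddCommGroup E] [NormedSpace ℝ E]
    (f : E → ℝ) (hf : ContDiff ℝ 2 f) (S : Set E) (hS : Convex ℝ S) (hSc : IsCompact S) :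
    ∃ C : ℝ, 0 ≤ C ∧ ∀ x ∈ S, ∀ y ∈ S, ∀ s ∈ Set.Icc (0 : ℝ) 1,
      f ((1 - s) • x + s • y) ≤ (1 - s) * f x + s * f y + C * s * (1 - s) * ‖x - y‖ ^ 2 := by
  have hf1 : ContDiff ℝ 1 (fderiv ℝ f) := hf.fderiv_right (by norm_num)
  have hd : Differentiable ℝ f := hf.differentiable (by norm_num)
  have hd1 : Differentiable ℝ (fderiv ℝ f) := hf1.differentiable (by norm_num)
  have hc2 : Continuous (fderiv ℝ (fderiv ℝ f)) := hf1.continuous_fderiv (by norm_num)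
  obtain ⟨L0, hL0⟩ := hSc.exists_bound_of_continuousOn
    (f := fderiv ℝ (fderiv ℝ f)) hc2.continuousOn
  set L := max L0 0
  have hL : ∀ x ∈ S, ‖fderiv ℝ (fderiv ℝ f) x‖ ≤ L := fun x hx =>
    (hL0 x hx).trans (le_max_left _ _)
  have hLn : 0 ≤ L := le_max_right _ _
  have hlip : ∀ z ∈ S, ∀ w ∈ S, ‖fderiv ℝ f w - fderiv ℝ f z‖ ≤ L * ‖w - z‖ := fun z hz w hw =>
    hS.norm_image_sub_le_of_norm_fderiv_le (fun x _ => hd1 x) hL hz hw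
  have htay : ∀ z ∈ S, ∀ x ∈ S, ‖f x - f z - fderiv ℝ f z (x - z)‖ ≤ L * ‖x - z‖ * ‖x - z‖ := by
    intro z hz x hx
    refine (convex_segment z x).norm_image_sub_le_of_norm_fderiv_le' (𝕜 := ℝ) (fun w _ => hd w) ?_
      (left_mem_segment ℝ z x) (right_mem_segment ℝ z x)
    intro w hw
    refine (hlip z hz w (hS.segment_subset hz hx hw)).trans ?_
    gcongr
    obtain ⟨t, ht, rfl⟩ := (segment_eq_image' ℝ z x) ▸ hw
    rw [add_sub_cancel_left, norm_smul, Real.norm_of_nonneg ht.1]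
    exact mul_le_of_le_one_left (norm_nonneg _) ht.2
  refine ⟨L, hLn, fun x hx y hy s hs => ?_⟩
  have hs0 := hs.1
  have hs1 : 0 ≤ 1 - s := sub_nonneg.2 hs.2
  set z := (1 - s) • x + s • y with hzdef
  have hz : z ∈ S := hS hx hy hs1 hs0 (by ring)
  have e1 : x - z = s • (x - y) := by rw [hzdef]; module
  have e2 : y - z = (-(1 - s)) • (x - y) := by rw [hzdef]; module
  have h1 := htay z hz x hx
  have h2 := htay z hz y hy
  rw [e1, map_smul, norm_smul, Real.norm_of_nonneg hs0] at h1
  rw [e2, map_smul, norm_smul, norm_neg, Real.norm_of_nonneg hs1] at h2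
  have h1' := (abs_le.1 h1).1
  have h2' := (abs_le.1 h2).1
  simp only [smul_eq_mul] at h1' h2'
  have a1 := mul_le_mul_of_nonneg_left h1' hs1
  have a2 := mul_le_mul_of_nonneg_left h2' hs0
  nlinarith

open scoped Pointwise in
lemma aux_compact {E : Type*} [NormedAddCommGroup E] (S : Set E) (hSc : IsCompact S) :
    IsCompact (S - S) := by
  have := (hSc.prod hSc).image (f := fun p : E × E => p.1 - p.2) (by fun_prop)
  rwa [Set.image_prod] at this

open scoped Pointwise in
lemma aux_semiconvex_sub {E : Type*} [NormedAddCommGroup E] [NormedSpace ℝ E]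
    (f : E → ℝ) (hf : ContDiff ℝ 2 f) (S : Set E) (hS : Convex ℝ S) (hSc : IsCompact S) :
    ∃ C : ℝ, 0 ≤ C ∧ ∀ x ∈ S, ∀ x' ∈ S, ∀ y ∈ S, ∀ y' ∈ S, ∀ s ∈ Set.Icc (0 : ℝ) 1,
      f ((1 - s) • (x - x') + s • (y - y')) ≤ (1 - s) * f (x - x') + s * f (y - y')
        + C * s * (1 - s) * ‖(x - x') - (y - y')‖ ^ 2 := by
  obtain ⟨C, h0, h⟩ := aux_semiconvex f hf (S - S) (hS.sub hS) (aux_compact S hSc)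
  exact ⟨C, h0, fun x hx x' hx' y hy y' hy' =>
    h _ (Set.sub_mem_sub hx hx') _ (Set.sub_mem_sub hy hy')⟩

lemma aux_lin {Ω : Type*} [MeasurableSpace Ω] (μ : Measure Ω) (h f g k : Ω → ℝ) (a b c : ℝ)
    (ih : Integrable h μ) (hf : Integrable f μ) (hg : Integrable g μ) (hk : Integrable k μ)
    (hle : ∀ᵐ w ∂μ, h w ≤ a * f w + b * g w + c * k w) :
    ∫ w, h w ∂μ ≤ a * ∫ w, f w ∂μ + b * ∫ w, g w ∂μ + c * ∫ w, k w ∂μ := by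
  have i1 : Integrable (fun w => a * f w + b * g w) μ := (hf.const_mul a).add (hg.const_mul b)
  have i2 : Integrable (fun w => a * f w + b * g w + c * k w) μ := i1.add (hk.const_mul c)
  rw [← integral_const_mul, ← integral_const_mul, ← integral_const_mul,
    ← integral_add (hf.const_mul a) (hg.const_mul b), ← integral_add i1 (hk.const_mul c)]
  exact integral_mono_ae ih i2 hle

lemma aux_integrable {Ω X : Type*} [MeasurableSpace Ω] [TopologicalSpace X] [MeasurableSpace X]
    [OpensMeasurableSpace X] (μ : Measure Ω) [IsFiniteMeasure μ] (g : Ω → X) (hg : Measurable g)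
    (f : X → ℝ) (hf : Continuous f) (S : Set X) (hS : IsCompact S) (h : ∀ᵐ w ∂μ, g w ∈ S) :
    Integrable (fun w => f (g w)) μ := by
  obtain ⟨C, hC⟩ := hS.exists_bound_of_continuousOn hf.continuousOn
  refine Integrable.of_bound (hf.measurable.comp hg).aestronglyMeasurable C ?_
  filter_upwards [h] with w hw using hC _ hw

lemma aux_prod {Ω : Type*} [MeasurableSpace Ω] (ρ : Measure Ω) [IsProbabilityMeasure ρ]
    {P : Ω → Prop} (h : ∀ᵐ w ∂ρ, P w) : ∀ᵐ q ∂(ρ.prod ρ), P q.1 ∧ P q.2 :=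
  (Measure.quasiMeasurePreserving_fst.ae h).and (Measure.quasiMeasurePreserving_snd.ae h)

open scoped Pointwise in
lemma aux_sub {n : ℕ} {Ω : Type*} [MeasurableSpace Ω] (ρ : Measure Ω) [IsProbabilityMeasure ρ]
    (K : Set (EuclideanSpace ℝ (Fin n))) (hK : IsCompact K)
    (F : EuclideanSpace ℝ (Fin n) → ℝ) (hF : Continuous F)
    (T : Ω → EuclideanSpace ℝ (Fin n)) (hT : Measurable T) (h : ∀ᵐ w ∂ρ, T w ∈ K) :
    Integrable (fun q : Ω × Ω => F (T q.1 - T q.2)) (ρ.prod ρ) := by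
  refine aux_integrable (ρ.prod ρ) (fun q : Ω × Ω => T q.1 - T q.2)
    ((hT.comp measurable_fst).sub (hT.comp measurable_snd)) F hF (K - K) (aux_compact K hK) ?_
  filter_upwards [aux_prod ρ h] with q hq using Set.sub_mem_sub hq.1 hq.2

lemma aux_Hone {n : ℕ} {Ω : Type*} [MeasurableSpace Ω] (ρ : Measure Ω) [IsProbabilityMeasure ρ]
    (K : Set (EuclideanSpace ℝ (Fin n))) (hK : IsCompact K)
    (F G : EuclideanSpace ℝ (Fin n) → ℝ) (hF : Continuous F) (hG : Continuous G)
    (T : Ω → EuclideanSpace ℝ (Fin n)) (hT : Measurable T) (h : ∀ᵐ w ∂ρ, T w ∈ K) :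
    Hone n F G (ρ.map T) =
      (1 / 2) * (∫ q, F (T q.1 - T q.2) ∂(ρ.prod ρ)) + ∫ w, G (T w) ∂ρ := by
  have : IsProbabilityMeasure (ρ.map T) := Measure.isProbabilityMeasure_map hT.aemeasurable
  unfold Hone
  rw [integral_map hT.aemeasurable hG.aestronglyMeasurable,
    integral_prod _ (aux_sub ρ K hK F hF T hT h)]
  have hm : StronglyMeasurable fun z => ∫ z', F (z - z') ∂(ρ.map T) := by
    have : StronglyMeasurable (Function.uncurry fun z z' : EuclideanSpace ℝ (Fin n) =>
        F (z - z')) := by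
      apply Continuous.stronglyMeasurable
      exact hF.comp (continuous_fst.sub continuous_snd)
    exact this.integral_prod_right
  rw [integral_map hT.aemeasurable hm.aestronglyMeasurable]
  congr 3
  ext w
  rw [integral_map hT.aemeasurable]
  exact (hF.comp (continuous_const.sub continuous_id)).aestronglyMeasurable

/-- For `F, G` of class `C²` and `K` convex compact, there is `C ≥ 0`
depending only on `F, G, K` such that for all probability measures `ν₀, ν₁` supported
in `K`, every coupling `ρ` and every `s ∈ [0,1]`,
`H¹(ν_s) ≤ (1−s) H¹(ν₀) + s H¹(ν₁) + C s(1−s) ∫ ‖z₀ − z₁‖² dρ`, where `ν_s` is the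
pushforward of `ρ` under `(z₀, z₁) ↦ (1−s)z₀ + s z₁`. In particular (taking `ρ` an
optimal coupling for `W₂`), `H¹` is semiconvex along geodesics. -/
theorem stmt_10 (n : ℕ) (hn : 1 ≤ n) (K : Set (EuclideanSpace ℝ (Fin n)))
    (hKconv : Convex ℝ K) (hKcomp : IsCompact K)
    (F G : EuclideanSpace ℝ (Fin n) → ℝ) (hF : ContDiff ℝ 2 F) (hG : ContDiff ℝ 2 G) :
    ∃ C : ℝ, 0 ≤ C ∧
      ∀ (ν₀ ν₁ : Measure (EuclideanSpace ℝ (Fin n))),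
        IsProbabilityMeasure ν₀ → IsProbabilityMeasure ν₁ →
        ν₀ Kᶜ = 0 → ν₁ Kᶜ = 0 →
      ∀ (ρ : Measure (EuclideanSpace ℝ (Fin n) × EuclideanSpace ℝ (Fin n))),
        IsProbabilityMeasure ρ → ρ.map Prod.fst = ν₀ → ρ.map Prod.snd = ν₁ →
      ∀ s ∈ Set.Icc (0 : ℝ) 1,
        Hone n F G (ρ.map (fun p => (1 - s) • p.1 + s • p.2)) ≤
          (1 - s) * Hone n F G ν₀ + s * Hone n F G ν₁ +
            C * s * (1 - s) * ∫ p, ‖p.1 - p.2‖ ^ 2 ∂ρ := by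
  obtain ⟨A, hA0, hA⟩ := aux_semiconvex_sub F hF K hKconv hKcomp
  obtain ⟨B, hB0, hB⟩ := aux_semiconvex G hG K hKconv hKcomp
  refine ⟨2 * A + B, by positivity, ?_⟩
  rintro _ _ - - h0 h1 ρ hρ rfl rfl s hs
  have hFc := hF.continuous
  have hGc := hG.continuous
  have hs0 := hs.1
  have hs1 : 0 ≤ 1 - s := sub_nonneg.2 hs.2
  have k0 : ∀ᵐ p ∂ρ, p.1 ∈ K := ae_of_ae_map measurable_fst.aemeasurable h0
  have k1 : ∀ᵐ p ∂ρ, p.2 ∈ K := ae_of_ae_map measurable_snd.aemeasurable h1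
  set T : EuclideanSpace ℝ (Fin n) × EuclideanSpace ℝ (Fin n) → EuclideanSpace ℝ (Fin n) :=
    fun p => (1 - s) • p.1 + s • p.2 with hTdef
  have hT : Measurable T := by
    apply Continuous.measurable
    fun_prop
  have kT : ∀ᵐ p ∂ρ, T p ∈ K := by
    filter_upwards [k0, k1] with p hp0 hp1 using hKconv hp0 hp1 hs1 hs0 (by ring)
  rw [aux_Hone ρ K hKcomp F G hFc hGc T hT kT,
    aux_Hone ρ K hKcomp F G hFc hGc _ measurable_fst k0,
    aux_Hone ρ K hKcomp F G hFc hGc _ measurable_snd k1]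
  have iD : Integrable (fun p : EuclideanSpace ℝ (Fin n) × EuclideanSpace ℝ (Fin n) =>
      ‖p.1 - p.2‖ ^ 2) ρ := by
    refine aux_integrable ρ (fun p => p) measurable_id (fun p => ‖p.1 - p.2‖ ^ 2)
      (by fun_prop) (K ×ˢ K) (hKcomp.prod hKcomp) ?_
    filter_upwards [k0, k1] with p hp0 hp1 using ⟨hp0, hp1⟩
  have iG0 := aux_integrable ρ _ measurable_fst G hGc K hKcomp k0
  have iG1 := aux_integrable ρ _ measurable_snd G hGc K hKcomp k1
  have iGT := aux_integrable ρ T hT G hGc K hKcomp kT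
  have iF0 := aux_sub ρ K hKcomp F hFc _ measurable_fst k0
  have iF1 := aux_sub ρ K hKcomp F hFc _ measurable_snd k1
  have iFT := aux_sub ρ K hKcomp F hFc T hT kT
  have iD1 := iD.comp_fst ρ
  have iD2 := iD.comp_snd ρ
  have eD1 := integral_fun_fst (μ := ρ) (ν := ρ)
    (fun p : EuclideanSpace ℝ (Fin n) × EuclideanSpace ℝ (Fin n) => ‖p.1 - p.2‖ ^ 2)
  have eD2 := integral_fun_snd (μ := ρ) (ν := ρ)
    (fun p : EuclideanSpace ℝ (Fin n) × EuclideanSpace ℝ (Fin n) => ‖p.1 - p.2‖ ^ 2)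
  simp only [probReal_univ, one_smul] at eD1 eD2
  have gG : ∫ p, G (T p) ∂ρ ≤ (1 - s) * ∫ p, G p.1 ∂ρ + s * ∫ p, G p.2 ∂ρ
      + B * s * (1 - s) * ∫ p, ‖p.1 - p.2‖ ^ 2 ∂ρ := by
    refine aux_lin ρ _ _ _ _ _ _ _ iGT iG0 iG1 iD ?_
    filter_upwards [k0, k1] with p hp0 hp1 using hB _ hp0 _ hp1 s hs
  have gF : ∫ q, F (T q.1 - T q.2) ∂(ρ.prod ρ) ≤ (1 - s) * ∫ q, F (q.1.1 - q.2.1) ∂(ρ.prod ρ)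
      + s * ∫ q, F (q.1.2 - q.2.2) ∂(ρ.prod ρ)
      + A * s * (1 - s) * 2 * (∫ q, ‖q.1.1 - q.1.2‖ ^ 2 ∂(ρ.prod ρ)
        + ∫ q, ‖q.2.1 - q.2.2‖ ^ 2 ∂(ρ.prod ρ)) := by
    rw [← integral_add iD1 iD2]
    refine aux_lin (ρ.prod ρ) _ _ _ _ _ _ _ iFT iF0 iF1 (iD1.add iD2) ?_
    filter_upwards [aux_prod ρ k0, aux_prod ρ k1] with q hq0 hq1
    have := hA _ hq0.1 _ hq0.2 _ hq1.1 _ hq1.2 s hs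
    have e : T q.1 - T q.2 = (1 - s) • (q.1.1 - q.2.1) + s • (q.1.2 - q.2.2) := by
      simp only [hTdef]; module
    rw [e]
    refine this.trans ?_
    have e3 : q.1.1 - q.2.1 - (q.1.2 - q.2.2) = (q.1.1 - q.1.2) - (q.2.1 - q.2.2) := by abel
    have hn := norm_sub_le (q.1.1 - q.1.2) (q.2.1 - q.2.2)
    rw [e3]
    have hsq : ‖(q.1.1 - q.1.2) - (q.2.1 - q.2.2)‖ ^ 2
        ≤ 2 * (‖q.1.1 - q.1.2‖ ^ 2 + ‖q.2.1 - q.2.2‖ ^ 2) :=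
      (pow_le_pow_left₀ (norm_nonneg _) hn 2).trans add_sq_le
    have := mul_le_mul_of_nonneg_left hsq (mul_nonneg (mul_nonneg hA0 hs0) hs1)
    linarith
  rw [eD1, eD2] at gF
  linarith
end

section
/- Let n, m ≥ 1, let K ⊆ ℝ^n be convex and compact, and let ω : ℝ^n → ℝ^m be twice continuously differentiable. Let ν₀, ν₁ be Borel probability measures on ℝ^n supported in K, let ρ be a coupling of ν₀ and ν₁, let ν_s be the pushforward of ρ under (z₀, z₁) ↦ (1−s)z₀ + s z₁, and set ξ_s = ∫ ω dν_s for s ∈ [0,1]. Then there exists C ≥ 0, depending only on ω and K, such that for all s ∈ [0,1]: ‖ξ_s − (1−s)ξ₀ − s ξ₁‖ ≤ C s(1−s) ∫ ‖z₀ − z₁‖² dρ(z₀, z₁). -/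
open MeasureTheory

theorem taylor_aux {E F : Type*} [NormedAddCommGroup E] [NormedSpace ℝ E]
    [NormedAddCommGroup F] [NormedSpace ℝ F] {K : Set E} (hK : Convex ℝ K) {ω : E → F}
    (hω : ContDiff ℝ 2 ω) {L : ℝ} (hL0 : 0 ≤ L)
    (hL : ∀ x ∈ K, ∀ y ∈ K, ‖fderiv ℝ ω y - fderiv ℝ ω x‖ ≤ L * ‖y - x‖)
    {x y : E} (hx : x ∈ K) (hy : y ∈ K) :
    ‖ω y - ω x - fderiv ℝ ω x (y - x)‖ ≤ L * ‖y - x‖ ^ 2 := by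
  have h := (convex_segment (𝕜 := ℝ) x y).norm_image_sub_le_of_norm_fderiv_le'
    (f := ω) (φ := fderiv ℝ ω x) (C := L * ‖y - x‖) (x := x) (y := y)
    (fun z _ => (hω.differentiable (by norm_num)).differentiableAt) ?_
    (left_mem_segment ℝ x y) (right_mem_segment ℝ x y)
  · linarith [h, sq (‖y - x‖)]
  · intro z hz
    refine (hL x hx z (hK.segment_subset hx hy hz)).trans ?_
    refine mul_le_mul_of_nonneg_left ?_ hL0
    obtain ⟨t, ht, rfl⟩ := segment_eq_image' ℝ x y ▸ hz
    simp only [add_sub_cancel_left, norm_smul, Real.norm_eq_abs, abs_of_nonneg ht.1]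
    exact mul_le_of_le_one_left (norm_nonneg _) ht.2

theorem interp_aux {E F : Type*} [NormedAddCommGroup E] [NormedSpace ℝ E]
    [NormedAddCommGroup F] [NormedSpace ℝ F] {K : Set E} (hK : Convex ℝ K) {ω : E → F}
    (hω : ContDiff ℝ 2 ω) {L : ℝ} (hL0 : 0 ≤ L)
    (hL : ∀ x ∈ K, ∀ y ∈ K, ‖fderiv ℝ ω y - fderiv ℝ ω x‖ ≤ L * ‖y - x‖)
    {a b : E} (ha : a ∈ K) (hb : b ∈ K) {s : ℝ} (h0 : 0 ≤ s) (h1 : s ≤ 1) :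
    ‖ω ((1 - s) • a + s • b) - (1 - s) • ω a - s • ω b‖ ≤
      L * s * (1 - s) * ‖a - b‖ ^ 2 := by
  have h1' : 0 ≤ 1 - s := by linarith
  have hz : (1 - s) • a + s • b ∈ K := hK ha hb h1' h0 (by ring)
  set z := (1 - s) • a + s • b with hzdef
  have ea : a - z = s • (a - b) := by rw [hzdef]; module
  have eb : b - z = (-(1 - s)) • (a - b) := by rw [hzdef]; module
  have ta := taylor_aux hK hω hL0 hL hz ha
  have tb := taylor_aux hK hω hL0 hL hz hb
  have key : ω z - (1 - s) • ω a - s • ω b =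
      -((1 - s) • (ω a - ω z - fderiv ℝ ω z (a - z)) +
        s • (ω b - ω z - fderiv ℝ ω z (b - z))) := by
    rw [ea, eb, map_smul, map_smul]; module
  rw [key, norm_neg]
  have na : ‖a - z‖ ^ 2 = s ^ 2 * ‖a - b‖ ^ 2 := by
    rw [ea, norm_smul, mul_pow, Real.norm_eq_abs, sq_abs]
  have nb : ‖b - z‖ ^ 2 = (1 - s) ^ 2 * ‖a - b‖ ^ 2 := by
    rw [eb, norm_smul, mul_pow, Real.norm_eq_abs, sq_abs, neg_sq]
  rw [na] at ta
  rw [nb] at tb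
  refine (norm_add_le _ _).trans ?_
  rw [norm_smul, norm_smul, Real.norm_of_nonneg h0, Real.norm_of_nonneg h1']
  calc _ ≤ (1 - s) * (L * (s ^ 2 * ‖a - b‖ ^ 2)) + s * (L * ((1 - s) ^ 2 * ‖a - b‖ ^ 2)) := by
        gcongr
    _ = _ := by ring

/-- For `ω : ℝ^n → ℝ^m` of class `C²` and `K` convex compact, there is
`C ≥ 0` depending only on `ω` and `K` such that for all probability measures
`ν₀, ν₁` supported in `K`, every coupling `ρ` of them, `ν_s` the pushforward of `ρ`
under `(z₀, z₁) ↦ (1−s)z₀ + s z₁`, and `ξ_s = ∫ ω dν_s`, one has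
`‖ξ_s − (1−s)ξ₀ − s ξ₁‖ ≤ C s(1−s) ∫ ‖z₀ − z₁‖² dρ` for all `s ∈ [0,1]`. -/
theorem stmt_11 (n m : ℕ) (hn : 1 ≤ n) (hm : 1 ≤ m)
    (K : Set (EuclideanSpace ℝ (Fin n))) (hKconv : Convex ℝ K) (hKcomp : IsCompact K)
    (ω : EuclideanSpace ℝ (Fin n) → EuclideanSpace ℝ (Fin m)) (hω : ContDiff ℝ 2 ω) :
    ∃ C : ℝ, 0 ≤ C ∧
      ∀ (ν₀ ν₁ : Measure (EuclideanSpace ℝ (Fin n))),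
        IsProbabilityMeasure ν₀ → IsProbabilityMeasure ν₁ →
        ν₀ Kᶜ = 0 → ν₁ Kᶜ = 0 →
      ∀ (ρ : Measure (EuclideanSpace ℝ (Fin n) × EuclideanSpace ℝ (Fin n))),
        IsProbabilityMeasure ρ → ρ.map Prod.fst = ν₀ → ρ.map Prod.snd = ν₁ →
      ∀ s ∈ Set.Icc (0 : ℝ) 1,
        ‖(∫ z, ω z ∂(ρ.map (fun p => (1 - s) • p.1 + s • p.2))) -
            (1 - s) • (∫ z, ω z ∂ν₀) - s • (∫ z, ω z ∂ν₁)‖ ≤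
          C * s * (1 - s) * ∫ p, ‖p.1 - p.2‖ ^ 2 ∂ρ := by
  have hD : ContDiff ℝ 1 (fderiv ℝ ω) := hω.fderiv_right (by norm_num)
  obtain ⟨L₀, hL₀⟩ := hKcomp.exists_bound_of_continuousOn
    (f := fderiv ℝ (fderiv ℝ ω)) (hD.continuous_fderiv (by norm_num)).continuousOn
  have hL : ∀ x ∈ K, ∀ y ∈ K, ‖fderiv ℝ ω y - fderiv ℝ ω x‖ ≤ max L₀ 0 * ‖y - x‖ := by
    intro x hx y hy
    exact hKconv.norm_image_sub_le_of_norm_fderiv_le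
      (fun z _ => (hD.differentiable (by norm_num)).differentiableAt)
      (fun z hz => (hL₀ z hz).trans (le_max_left _ _)) hx hy
  have hL0 : (0 : ℝ) ≤ max L₀ 0 := le_max_right _ _
  refine ⟨max L₀ 0, hL0, ?_⟩
  rintro ν₀ ν₁ - - hν₀ hν₁ ρ hρ rfl rfl s ⟨h0, h1⟩
  have hωc := hω.continuous
  have hmeas : MeasurableSet Kᶜ := hKcomp.isClosed.measurableSet.compl
  rw [Measure.map_apply measurable_fst hmeas] at hν₀
  rw [Measure.map_apply measurable_snd hmeas] at hν₁
  have a0 : ∀ᵐ p ∂ρ, p.1 ∈ K := by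
    rw [ae_iff]; exact hν₀
  have a1 : ∀ᵐ p ∂ρ, p.2 ∈ K := by
    rw [ae_iff]; exact hν₁
  have hint : ∀ {G : Type} [NormedAddCommGroup G] [SecondCountableTopology G]
      (g : EuclideanSpace ℝ (Fin n) × EuclideanSpace ℝ (Fin n) → G),
      Continuous g → Integrable g ρ := by
    intro G _ _ g hg
    obtain ⟨B, hB⟩ := (hKcomp.prod hKcomp).exists_bound_of_continuousOn hg.continuousOn
    refine Integrable.of_bound hg.aestronglyMeasurable B ?_
    filter_upwards [a0, a1] with p h h' using hB p ⟨h, h'⟩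
  have is := hint (fun p => ω ((1 - s) • p.1 + s • p.2)) (by fun_prop)
  have i0 := hint (fun p => (1 - s) • ω p.1) (by fun_prop)
  have i1 := hint (fun p => s • ω p.2) (by fun_prop)
  have id := hint (fun p => ω ((1 - s) • p.1 + s • p.2) - (1 - s) • ω p.1) (by fun_prop)
  have iq := hint (fun p => ‖p.1 - p.2‖ ^ 2) (by fun_prop)
  rw [integral_map (by fun_prop) hωc.aestronglyMeasurable,
    integral_map (by fun_prop) hωc.aestronglyMeasurable,
    integral_map (by fun_prop) hωc.aestronglyMeasurable,
    ← integral_smul, ← integral_smul, ← integral_sub is i0,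
    ← integral_sub id i1, ← integral_const_mul]
  refine norm_integral_le_of_norm_le (iq.const_mul _) ?_
  filter_upwards [a0, a1] with p h h' using interp_aux hKconv hω hL0 hL h h' h0 h1
end

section
/- Let n, m ≥ 1, let K ⊆ ℝ^n be convex and compact, let ℓ : ℝ^n × ℝ^m → ℝ and ω : ℝ^n → ℝ^m be twice continuously differentiable. Let z₀, z₁ ∈ K and set z_s = (1−s)z₀ + s z₁ for s ∈ [0,1]. Let ν₀, ν₁ be Borel probability measures on ℝ^n supported in K, let ρ be a coupling of ν₀ and ν₁, let ν_s be the pushforward of ρ under (w₀, w₁) ↦ (1−s)w₀ + s w₁, and set ξ_s = ∫ ω dν_s. Then there exists a constant C ≥ 0 depending only on K, ℓ and ω such that for all s ∈ [0,1]: ℓ(z_s, ξ_s) ≤ (1−s) ℓ(z₀, ξ₀) + s ℓ(z₁, ξ₁) + C s(1−s) ∫ ‖w₀ − w₁‖² dρ(w₀, w₁) + C s(1−s) ‖z₀ − z₁‖². -/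
open MeasureTheory

lemma aux_lip {E F : Type*} [NormedAddCommGroup E] [NormedSpace ℝ E]
    [NormedAddCommGroup F] [NormedSpace ℝ F] (f : E → F) (hf : ContDiff ℝ 1 f)
    (S : Set E) (hc : Convex ℝ S) (hS : IsCompact S) :
    ∃ L : ℝ, 0 ≤ L ∧ ∀ x ∈ S, ∀ y ∈ S, ‖f y - f x‖ ≤ L * ‖y - x‖ := by
  obtain ⟨L, hL⟩ := hS.exists_bound_of_continuousOn
    (hf.continuous_fderiv (by norm_num)).continuousOn
  refine ⟨max L 0, le_max_right _ _, fun x hx y hy => ?_⟩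
  exact hc.norm_image_sub_le_of_norm_fderiv_le (𝕜 := ℝ)
    (fun z _ => (hf.differentiable (by norm_num)) z)
    (fun z hz => (hL z hz).trans (le_max_left _ _)) hx hy

lemma aux_quad {E F : Type*} [NormedAddCommGroup E] [NormedSpace ℝ E]
    [NormedAddCommGroup F] [NormedSpace ℝ F] (f : E → F) (hf : ContDiff ℝ 2 f)
    (S : Set E) (hc : Convex ℝ S) (hS : IsCompact S) :
    ∃ M : ℝ, 0 ≤ M ∧ ∀ x ∈ S, ∀ y ∈ S, ∀ s ∈ Set.Icc (0 : ℝ) 1,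
      ‖f ((1 - s) • x + s • y) - ((1 - s) • f x + s • f y)‖ ≤
        M * s * (1 - s) * ‖x - y‖ ^ 2 := by
  obtain ⟨M, hM0, hM⟩ := aux_lip (fderiv ℝ f) (hf.fderiv_right (by norm_num)) S hc hS
  have hd : Differentiable ℝ f := hf.differentiable (by norm_num)
  have key : ∀ c ∈ S, ∀ y ∈ S, ‖f y - f c - fderiv ℝ f c (y - c)‖ ≤ M * ‖y - c‖ ^ 2 := by
    intro c hcS y hy
    have h := (convex_segment (𝕜 := ℝ) c y).norm_image_sub_le_of_norm_fderiv_le' (𝕜 := ℝ)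
      (f := f) (φ := fderiv ℝ f c) (C := M * ‖y - c‖)
      (fun z _ => hd z)
      (fun z hz => (hM c hcS z (hc.segment_subset hcS hy hz)).trans ?_)
      (left_mem_segment ℝ c y) (right_mem_segment ℝ c y)
    · calc _ ≤ _ := h
        _ = _ := by ring
    · gcongr
      obtain ⟨t, ht, rfl⟩ := (segment_eq_image' ℝ c y ▸ hz)
      simp only [add_sub_cancel_left, norm_smul, Real.norm_eq_abs, abs_of_nonneg ht.1]
      exact mul_le_of_le_one_left (norm_nonneg _) ht.2
  refine ⟨M, hM0, fun x hx y hy s hs => ?_⟩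
  obtain ⟨h0, h1⟩ := hs
  have h1' : 0 ≤ 1 - s := by linarith
  set c := (1 - s) • x + s • y with hcdef
  have hcS : c ∈ S := hc hx hy h1' h0 (by ring)
  have ex : x - c = s • (x - y) := by rw [hcdef]; module
  have ey : y - c = (-(1 - s)) • (x - y) := by rw [hcdef]; module
  have kx := key c hcS x hx
  have ky := key c hcS y hy
  rw [ex] at kx
  rw [ey] at ky
  set A := fderiv ℝ f c
  rw [map_smul, norm_smul, Real.norm_eq_abs, abs_of_nonneg h0] at kx
  rw [map_smul, norm_smul, norm_neg, Real.norm_eq_abs, abs_of_nonneg h1'] at ky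
  have e : f c - ((1 - s) • f x + s • f y) =
      -((1 - s) • (f x - f c - s • A (x - y)) + s • (f y - f c - (-(1 - s)) • A (x - y))) := by
    module
  rw [e, norm_neg]
  refine (norm_add_le _ _).trans ?_
  rw [norm_smul, norm_smul, Real.norm_eq_abs, Real.norm_eq_abs, abs_of_nonneg h0,
    abs_of_nonneg h1']
  have a1 := mul_le_mul_of_nonneg_left kx h1'
  have a2 := mul_le_mul_of_nonneg_left ky h0
  calc _ ≤ _ := add_le_add a1 a2
    _ = _ := by ring

/-- For `ℓ : ℝ^n × ℝ^m → ℝ` and `ω : ℝ^n → ℝ^m` of class `C²` and `K`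
convex compact, there is `C ≥ 0` depending only on `K, ℓ, ω` such that for all
`z₀, z₁ ∈ K` with `z_s = (1−s)z₀ + s z₁`, all probability measures `ν₀, ν₁` supported
in `K`, every coupling `ρ`, `ν_s` the pushforward of `ρ` under interpolation and
`ξ_s = ∫ ω dν_s`, one has for all `s ∈ [0,1]`:
`ℓ(z_s, ξ_s) ≤ (1−s) ℓ(z₀, ξ₀) + s ℓ(z₁, ξ₁) + C s(1−s) ∫ ‖w₀ − w₁‖² dρ + C s(1−s) ‖z₀ − z₁‖²`. -/
theorem stmt_12 (n m : ℕ) (hn : 1 ≤ n) (hm : 1 ≤ m)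
    (K : Set (EuclideanSpace ℝ (Fin n))) (hKconv : Convex ℝ K) (hKcomp : IsCompact K)
    (ℓ : EuclideanSpace ℝ (Fin n) × EuclideanSpace ℝ (Fin m) → ℝ) (hℓ : ContDiff ℝ 2 ℓ)
    (ω : EuclideanSpace ℝ (Fin n) → EuclideanSpace ℝ (Fin m)) (hω : ContDiff ℝ 2 ω) :
    ∃ C : ℝ, 0 ≤ C ∧
      ∀ z₀ ∈ K, ∀ z₁ ∈ K,
      ∀ (ν₀ ν₁ : Measure (EuclideanSpace ℝ (Fin n))),
        IsProbabilityMeasure ν₀ → IsProbabilityMeasure ν₁ →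
        ν₀ Kᶜ = 0 → ν₁ Kᶜ = 0 →
      ∀ (ρ : Measure (EuclideanSpace ℝ (Fin n) × EuclideanSpace ℝ (Fin n))),
        IsProbabilityMeasure ρ → ρ.map Prod.fst = ν₀ → ρ.map Prod.snd = ν₁ →
      ∀ s ∈ Set.Icc (0 : ℝ) 1,
        ℓ ((1 - s) • z₀ + s • z₁,
            ∫ w, ω w ∂(ρ.map (fun p => (1 - s) • p.1 + s • p.2))) ≤
          (1 - s) * ℓ (z₀, ∫ w, ω w ∂ν₀) + s * ℓ (z₁, ∫ w, ω w ∂ν₁) +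
            C * s * (1 - s) * (∫ p, ‖p.1 - p.2‖ ^ 2 ∂ρ) +
            C * s * (1 - s) * ‖z₀ - z₁‖ ^ 2 := by
  obtain ⟨R, hR⟩ := hKcomp.exists_bound_of_continuousOn hω.continuous.continuousOn
  obtain ⟨L1, hL10, hL1⟩ := aux_lip ω (hω.of_le (by norm_num)) K hKconv hKcomp
  obtain ⟨M1, hM10, hM1⟩ := aux_quad ω hω K hKconv hKcomp
  have hSc : Convex ℝ (K ×ˢ Metric.closedBall (0 : EuclideanSpace ℝ (Fin m)) R) :=
    hKconv.prod (convex_closedBall _ _)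
  have hSk : IsCompact (K ×ˢ Metric.closedBall (0 : EuclideanSpace ℝ (Fin m)) R) :=
    hKcomp.prod (isCompact_closedBall _ _)
  obtain ⟨L2, hL20, hL2⟩ := aux_lip ℓ (hℓ.of_le (by norm_num)) _ hSc hSk
  obtain ⟨M2, hM20, hM2⟩ := aux_quad ℓ hℓ _ hSc hSk
  refine ⟨L2 * M1 + M2 * L1 ^ 2 + M2, by positivity, ?_⟩
  intro z₀ hz₀ z₁ hz₁ ν₀ ν₁ _ _ hν₀ hν₁ ρ _ hρ₀ hρ₁ s hs
  have h0 := hs.1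
  have h1 : 0 ≤ 1 - s := by linarith [hs.2]
  have hKm : MeasurableSet Kᶜ := hKcomp.isClosed.measurableSet.compl
  have ae0 : ∀ᵐ p ∂ρ, p.1 ∈ K := by
    rw [← hρ₀, Measure.map_apply measurable_fst hKm] at hν₀
    exact hν₀
  have ae1 : ∀ᵐ p ∂ρ, p.2 ∈ K := by
    rw [← hρ₁, Measure.map_apply measurable_snd hKm] at hν₁
    exact hν₁
  have aes : ∀ᵐ p ∂ρ, (1 - s) • p.1 + s • p.2 ∈ K := by
    filter_upwards [ae0, ae1] with p hp0 hp1
    exact hKconv hp0 hp1 h1 h0 (by ring)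
  have hωc := hω.continuous
  have hcs : Continuous (fun p : EuclideanSpace ℝ (Fin n) × EuclideanSpace ℝ (Fin n) =>
    (1 - s) • p.1 + s • p.2) := by fun_prop
  rw [← hρ₀, ← hρ₁,
    integral_map hcs.measurable.aemeasurable hωc.aestronglyMeasurable,
    integral_map measurable_fst.aemeasurable hωc.aestronglyMeasurable,
    integral_map measurable_snd.aemeasurable hωc.aestronglyMeasurable]
  have b0 : ∀ᵐ p ∂ρ, ‖ω p.1‖ ≤ R := ae0.mono fun p hp => hR _ hp
  have b1 : ∀ᵐ p ∂ρ, ‖ω p.2‖ ≤ R := ae1.mono fun p hp => hR _ hp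
  have bs : ∀ᵐ p ∂ρ, ‖ω ((1 - s) • p.1 + s • p.2)‖ ≤ R := aes.mono fun p hp => hR _ hp
  have i0 : Integrable (fun p => ω p.1) ρ :=
    Integrable.of_bound (hωc.comp continuous_fst).aestronglyMeasurable R b0
  have i1 : Integrable (fun p => ω p.2) ρ :=
    Integrable.of_bound (hωc.comp continuous_snd).aestronglyMeasurable R b1
  have is : Integrable (fun p => ω ((1 - s) • p.1 + s • p.2)) ρ :=
    Integrable.of_bound (hωc.comp hcs).aestronglyMeasurable R bs
  have n0 : ‖∫ p, ω p.1 ∂ρ‖ ≤ R := by simpa using norm_integral_le_of_norm_le_const b0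
  have n1 : ‖∫ p, ω p.2 ∂ρ‖ ≤ R := by simpa using norm_integral_le_of_norm_le_const b1
  have ns : ‖∫ p, ω ((1 - s) • p.1 + s • p.2) ∂ρ‖ ≤ R := by
    simpa using norm_integral_le_of_norm_le_const bs
  obtain ⟨D, hD⟩ := (hKcomp.prod hKcomp).exists_bound_of_continuousOn
    (f := fun p => p.1 - p.2) (by fun_prop)
  have bD : ∀ᵐ p ∂ρ, ‖p.1 - p.2‖ ≤ D := by
    filter_upwards [ae0, ae1] with p hp0 hp1
    exact hD p ⟨hp0, hp1⟩
  have id2 : Integrable (fun p => ‖p.1 - p.2‖ ^ 2) ρ := by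
    refine Integrable.of_bound (Continuous.aestronglyMeasurable (by fun_prop)) (D ^ 2) ?_
    filter_upwards [bD] with p hp
    rw [norm_pow, norm_norm]
    gcongr
  have id1 : Integrable (fun p => ‖p.1 - p.2‖) ρ := by
    refine Integrable.of_bound (Continuous.aestronglyMeasurable (by fun_prop)) D ?_
    filter_upwards [bD] with p hp
    rwa [norm_norm]
  set ξ₀ := ∫ p, ω p.1 ∂ρ with hξ₀
  set ξ₁ := ∫ p, ω p.2 ∂ρ with hξ₁
  set ξs := ∫ p, ω ((1 - s) • p.1 + s • p.2) ∂ρ with hξs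
  set W := ∫ p, ‖p.1 - p.2‖ ^ 2 ∂ρ with hW
  have jen : (∫ p, ‖p.1 - p.2‖ ∂ρ) ^ 2 ≤ W :=
    (convexOn_pow 2).map_integral_le (g := fun x : ℝ => x ^ 2) (s := Set.Ici 0)
      (by fun_prop) isClosed_Ici (Filter.Eventually.of_forall fun p => norm_nonneg _) id1 id2
  have d01 : ‖ξ₀ - ξ₁‖ ≤ L1 * ∫ p, ‖p.1 - p.2‖ ∂ρ := by
    rw [hξ₀, hξ₁, ← integral_sub i0 i1, ← integral_const_mul]
    refine norm_integral_le_of_norm_le (id1.const_mul _) ?_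
    filter_upwards [ae0, ae1] with p hp0 hp1
    exact hL1 _ hp1 _ hp0
  have d01' : ‖ξ₀ - ξ₁‖ ^ 2 ≤ L1 ^ 2 * W := by
    calc ‖ξ₀ - ξ₁‖ ^ 2 ≤ (L1 * ∫ p, ‖p.1 - p.2‖ ∂ρ) ^ 2 := by gcongr
      _ = L1 ^ 2 * (∫ p, ‖p.1 - p.2‖ ∂ρ) ^ 2 := by ring
      _ ≤ _ := by gcongr
  have ds : ‖ξs - ((1 - s) • ξ₀ + s • ξ₁)‖ ≤ M1 * s * (1 - s) * W := by
    have i0' : Integrable (fun p => (1 - s) • ω p.1) ρ := i0.smul (1 - s)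
    have i1' : Integrable (fun p => s • ω p.2) ρ := i1.smul s
    have i01 : Integrable (fun p => (1 - s) • ω p.1 + s • ω p.2) ρ := i0'.add i1'
    rw [hξs, hξ₀, hξ₁, ← integral_smul, ← integral_smul, ← integral_add i0' i1',
      ← integral_sub is i01, hW, ← integral_const_mul]
    refine norm_integral_le_of_norm_le (id2.const_mul _) ?_
    filter_upwards [ae0, ae1] with p hp0 hp1
    exact hM1 _ hp0 _ hp1 s hs
  have m0 : ξ₀ ∈ Metric.closedBall (0 : EuclideanSpace ℝ (Fin m)) R := by simpa using n0
  have m1 : ξ₁ ∈ Metric.closedBall (0 : EuclideanSpace ℝ (Fin m)) R := by simpa using n1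
  have ms : ξs ∈ Metric.closedBall (0 : EuclideanSpace ℝ (Fin m)) R := by simpa using ns
  have mb : (1 - s) • ξ₀ + s • ξ₁ ∈ Metric.closedBall (0 : EuclideanSpace ℝ (Fin m)) R :=
    convex_closedBall _ _ m0 m1 h1 h0 (by ring)
  have mz : (1 - s) • z₀ + s • z₁ ∈ K := hKconv hz₀ hz₁ h1 h0 (by ring)
  have q1 := hL2 ((1 - s) • z₀ + s • z₁, (1 - s) • ξ₀ + s • ξ₁) ⟨mz, mb⟩
    ((1 - s) • z₀ + s • z₁, ξs) ⟨mz, ms⟩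
  rw [Prod.mk_sub_mk, sub_self, Prod.norm_mk, norm_zero, max_eq_right (norm_nonneg _)] at q1
  have q2 := hM2 (z₀, ξ₀) ⟨hz₀, m0⟩ (z₁, ξ₁) ⟨hz₁, m1⟩ s hs
  rw [Prod.smul_mk, Prod.smul_mk, Prod.mk_add_mk, Prod.mk_sub_mk, Prod.norm_mk] at q2
  have q3 : max ‖z₀ - z₁‖ ‖ξ₀ - ξ₁‖ ^ 2 ≤ ‖z₀ - z₁‖ ^ 2 + L1 ^ 2 * W := by
    rcases max_choice ‖z₀ - z₁‖ ‖ξ₀ - ξ₁‖ with h | h <;> rw [h] <;>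
      nlinarith [sq_nonneg ‖z₀ - z₁‖, sq_nonneg ‖ξ₀ - ξ₁‖]
  have q1' := (le_abs_self _).trans (q1.trans (mul_le_mul_of_nonneg_left ds hL20))
  have hnn : 0 ≤ M2 * s * (1 - s) := by positivity
  have q2' := (le_abs_self _).trans (q2.trans (mul_le_mul_of_nonneg_left q3 hnn))
  simp only [smul_eq_mul] at q2'
  have hz : 0 ≤ (L2 * M1 + M2 * L1 ^ 2) * s * (1 - s) * ‖z₀ - z₁‖ ^ 2 := by positivity
  have hW0 : 0 ≤ W := integral_nonneg fun p => by positivity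
  have hz' : 0 ≤ M2 * s * (1 - s) * W := by positivity
  linarith
end
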